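/- For all integers s > r ≥ 2: (i) for every real ε > 0 there exists n₀ such that every strongly K_s-saturated graph on n ≥ n₀ vertices contains at least (C(s-2, r-1) - ε)·n copies of K_r; and (ii) for every n ≥ s, there is a strongly K_s-saturated graph on n vertices with exactly (n - s + 2)·C(s-2, r-1) + C(s-2, r) copies of K_r. Consequently ssat(n, K_r, K_s) = n·C(s-2, r-1) - o(n). -/

import Mathlib

open SimpleGraph Finset

variable {V : Type*}

/-- The graph `G` with the edge `u v` added. -/
def addEdge (G : SimpleGraph V) (u v : V) : SimpleGraph V :=
  G ⊔ SimpleGraph.fromEdgeSet {s(u, v)}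

/-- `G` is `K_s`-saturated: `G` is `K_s`-free and adding any missing edge creates a `K_s`. -/
def KSat (s : ℕ) (G : SimpleGraph V) : Prop :=
  G.CliqueFree s ∧ ∀ u v : V, u ≠ v → ¬ G.Adj u v → ¬ (addEdge G u v).CliqueFree s

/-- The number of copies of `K_r` in `G`: the number of `r`-sets of vertices inducing
a complete graph. -/
noncomputable def cliqueCount (G : SimpleGraph V) (r : ℕ) : ℕ :=
  {t : Finset V | G.IsNClique r t}.ncard

/-- `sat(n, K_r, K_s)`: minimum number of copies of `K_r` in an `n`-vertex
`K_s`-saturated graph. -/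
noncomputable def satCliques (n r s : ℕ) : ℕ :=
  sInf {m | ∃ G : SimpleGraph (Fin n), KSat s G ∧ cliqueCount G r = m}

/-- The join `K_{s-2} ∗ ∅_{n-s+2}` on `Fin n`. -/
def joinGraph (n s : ℕ) : SimpleGraph (Fin n) :=
  SimpleGraph.fromRel (fun i _ => (i : ℕ) < s - 2)

/-- The number of copies of `C_r` in `G` : the number of subgraphs of `G`
isomorphic to the cycle on `r` vertices. -/
noncomputable def cycleCount (G : SimpleGraph V) (r : ℕ) : ℕ :=
  {H : G.Subgraph | Nonempty (H.coe ≃g cycleGraph r)}.ncard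

/-- `sat(n, C_r, K_s)`. -/
noncomputable def satCyclesCliqueSat (n r s : ℕ) : ℕ :=
  sInf {m | ∃ G : SimpleGraph (Fin n), KSat s G ∧ cycleCount G r = m}

/-- `G` contains a copy of `F`, i.e. a subgraph isomorphic to `F`. -/
def ContainsCopy {α β : Type*} (F : SimpleGraph α) (G : SimpleGraph β) : Prop :=
  ∃ f : α → β, Function.Injective f ∧ ∀ a b : α, F.Adj a b → G.Adj (f a) (f b)

/-- strongly K_s-saturated -/
def StronglyKSat (s : ℕ) (G : SimpleGraph V) : Prop :=
  ∀ u v : V, u ≠ v → ¬ G.Adj u v →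
    ∃ t : Finset V, (addEdge G u v).IsNClique s t ∧ u ∈ t ∧ v ∈ t

/-- dumbbell -/
def dumbbell (m : ℕ) : SimpleGraph (Fin (2 * m)) :=
  SimpleGraph.fromRel (fun i j =>
    ((i : ℕ) < m ∧ (j : ℕ) < m) ∨ (m ≤ (i : ℕ) ∧ m ≤ (j : ℕ)) ∨ ((i : ℕ) = 0 ∧ (j : ℕ) = m))

def Vgraph (m : ℕ) : SimpleGraph (Fin (m + 2)) :=
  SimpleGraph.fromRel (fun i j =>
    ((i : ℕ) < m ∧ (j : ℕ) < m) ∨ ((i : ℕ) = 0 ∧ m ≤ (j : ℕ)))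

def lambdaGraph (m : ℕ) : SimpleGraph (Fin (m + 1)) :=
  SimpleGraph.fromRel (fun i j =>
    ((i : ℕ) < m ∧ (j : ℕ) < m) ∨ ((i : ℕ) = m ∧ (j : ℕ) < 2))

def VgraphGen (m r : ℕ) : SimpleGraph (Fin (m + (m - r))) :=
  SimpleGraph.fromRel (fun i j =>
    ((i : ℕ) < m ∧ (j : ℕ) < m) ∨
      (((i : ℕ) = 0 ∨ m ≤ (i : ℕ)) ∧ ((j : ℕ) = 0 ∨ m ≤ (j : ℕ))))

def lambdaGraphGen (m r : ℕ) : SimpleGraph (Fin (m + 1)) :=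
  SimpleGraph.fromRel (fun i j =>
    ((i : ℕ) < m ∧ (j : ℕ) < m) ∨ ((i : ℕ) = m ∧ (j : ℕ) < r))

/-- `G` is saturated with respect to the family `{F₁, F₂, F₃}`. -/
def FamSat3 {α₁ α₂ α₃ : Type*} (F₁ : SimpleGraph α₁) (F₂ : SimpleGraph α₂)
    (F₃ : SimpleGraph α₃) (G : SimpleGraph V) : Prop :=
  ¬ ContainsCopy F₁ G ∧ ¬ ContainsCopy F₂ G ∧ ¬ ContainsCopy F₃ G ∧
    ∀ u v : V, u ≠ v → ¬ G.Adj u v →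
      ContainsCopy F₁ (addEdge G u v) ∨ ContainsCopy F₂ (addEdge G u v) ∨
        ContainsCopy F₃ (addEdge G u v)

noncomputable def satFam3 {α₁ α₂ α₃ : Type*} (n : ℕ) (F₁ : SimpleGraph α₁)
    (F₂ : SimpleGraph α₂) (F₃ : SimpleGraph α₃) : ℕ :=
  sInf {m | ∃ G : SimpleGraph (Fin n), FamSat3 F₁ F₂ F₃ G ∧ G.edgeSet.ncard = m}

noncomputable def satCliquesFam3 {α₁ α₂ α₃ : Type*} (n r : ℕ) (F₁ : SimpleGraph α₁)
    (F₂ : SimpleGraph α₂) (F₃ : SimpleGraph α₃) : ℕ :=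
  sInf {m | ∃ G : SimpleGraph (Fin n), FamSat3 F₁ F₂ F₃ G ∧ cliqueCount G r = m}

/-- saturation w.r.t. a single graph, with copies as subgraphs. -/
def SatGraph {α : Type*} (F : SimpleGraph α) (G : SimpleGraph V) : Prop :=
  ¬ ContainsCopy F G ∧ ∀ u v : V, u ≠ v → ¬ G.Adj u v → ContainsCopy F (addEdge G u v)

noncomputable def satCyclesGraphSat {α : Type*} (n r : ℕ) (F : SimpleGraph α) : ℕ :=
  sInf {m | ∃ G : SimpleGraph (Fin n), SatGraph F G ∧ cycleCount G r = m}

/-- number of independent sets of size l -/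
noncomputable def indepCount (G : SimpleGraph V) (l : ℕ) : ℕ :=
  {t : Finset V | t.card = l ∧ ∀ a ∈ t, ∀ b ∈ t, ¬ G.Adj a b}.ncard

/-- Ramsey number -/
noncomputable def ramsey (l s : ℕ) : ℕ :=
  sInf {N | ∀ G : SimpleGraph (Fin N),
    (∃ t : Finset (Fin N), t.card = l ∧ ∀ a ∈ t, ∀ b ∈ t, ¬ G.Adj a b) ∨
      ∃ t : Finset (Fin N), G.IsNClique s t}

/-- `ssat(n, K_r, K_s)`: minimum number of copies of `K_r` over `n`-vertex strongly
`K_s`-saturated graphs. -/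
noncomputable def ssatCliques (n r s : ℕ) : ℕ :=
  sInf {m | ∃ G : SimpleGraph (Fin n), StronglyKSat s G ∧ cliqueCount G r = m}

open Classical in
/-- The vertices lying in a common copy of `K_r` with `v`. -/
noncomputable def cliqueSpan [Fintype V] (G : SimpleGraph V) (r : ℕ) (v : V) : Finset V :=
  univ.filter fun x => ∃ t : Finset V, G.IsNClique r t ∧ v ∈ t ∧ x ∈ t

/-- The neighbourhood of `v` contains an `m`-clique inside `C`. -/
def CoveredBy (G : SimpleGraph V) (m : ℕ) (C : Finset V) (v : V) : Prop :=
  ∃ Q ⊆ C, G.IsNClique m Q ∧ ∀ x ∈ Q, G.Adj v x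

lemma CoveredBy.mono {G : SimpleGraph V} {m : ℕ} {C D : Finset V} {v : V} (hCD : C ⊆ D)
    (h : CoveredBy G m C v) : CoveredBy G m D v := by
  obtain ⟨Q, hQ, h⟩ := h
  exact ⟨Q, hQ.trans hCD, h⟩

open Classical in
lemma cliqueCount_eq_card_filter [Fintype V] (G : SimpleGraph V) (r : ℕ) :
    cliqueCount G r = (univ.filter fun t : Finset V => G.IsNClique r t).card := by
  rw [cliqueCount, ← Set.ncard_coe_finset]
  simp

lemma sum_card_cliqueSpan_le [Fintype V] (G : SimpleGraph V) (r : ℕ) :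
    ∑ v, (cliqueSpan G r v).card ≤ r ^ 2 * cliqueCount G r := by
  classical
  rw [cliqueCount_eq_card_filter]
  set K := univ.filter fun t : Finset V => G.IsNClique r t with hK
  have h1 : ∀ v, (cliqueSpan G r v).card ≤ ∑ t ∈ K, if v ∈ t then r else 0 := by
    intro v
    have hsub : cliqueSpan G r v ⊆ (K.filter fun t => v ∈ t).biUnion id := by
      intro x hx
      simp only [cliqueSpan, mem_filter, mem_univ, true_and] at hx
      obtain ⟨t, ht, hv, hx⟩ := hx
      simp only [mem_biUnion, mem_filter, id]
      exact ⟨t, ⟨by simp [hK, ht], hv⟩, hx⟩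
    refine (card_le_card hsub).trans (card_biUnion_le.trans ?_)
    rw [← sum_filter]
    refine sum_le_sum fun t ht => ?_
    simp only [hK, mem_filter, mem_univ, true_and] at ht
    exact ht.1.card_eq.le
  refine (sum_le_sum fun v _ => h1 v).trans ?_
  rw [sum_comm]
  have h2 : ∀ t ∈ K, (∑ v, if v ∈ t then r else 0) = r ^ 2 := by
    intro t ht
    simp only [hK, mem_filter, mem_univ, true_and] at ht
    rw [← sum_filter]
    simp [ht.card_eq, sq]
  rw [sum_congr rfl h2]
  simp [mul_comm]

lemma StronglyKSat.exists_common_clique {s : ℕ} {G : SimpleGraph V} (hG : StronglyKSat s G)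
    {u v : V} (huv : u ≠ v) (h : ¬ G.Adj u v) :
    ∃ Q : Finset V, G.IsNClique (s - 2) Q ∧ ∀ x ∈ Q, G.Adj u x ∧ G.Adj v x := by
  classical
  obtain ⟨t, ht, hu, hv⟩ := hG u v huv h
  have hadj : ∀ a ∈ t, ∀ b ∈ t, a ≠ b → b ≠ u → b ≠ v → G.Adj a b := by
    intro a ha b hb hab hbu hbv
    have := ht.1 ha hb hab
    simp only [addEdge, sup_adj, fromEdgeSet_adj, Set.mem_singleton_iff, Sym2.eq_iff] at this
    grind
  refine ⟨(t.erase u).erase v, ⟨?_, ?_⟩, ?_⟩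
  · intro a ha b hb hab
    simp only [coe_erase, Set.mem_sdiff, mem_coe, Set.mem_singleton_iff] at ha hb
    exact hadj a ha.1.1 b hb.1.1 hab hb.1.2 hb.2
  · rw [card_erase_of_mem (mem_erase.2 ⟨huv.symm, hv⟩), card_erase_of_mem hu, ht.card_eq]
    omega
  · intro x hx
    simp only [mem_erase] at hx
    exact ⟨hadj u hu x hx.2.2 (Ne.symm hx.2.1) hx.2.1 hx.1,
      hadj v hv x hx.2.2 (Ne.symm hx.1) hx.2.1 hx.1⟩

lemma subset_cliqueSpan_of_isNClique [Fintype V] {G : SimpleGraph V} {r m : ℕ} (hr : 2 ≤ r)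
    (hrm : r ≤ m + 1) {Q : Finset V} {v : V} (hQ : G.IsNClique m Q) (hv : ∀ x ∈ Q, G.Adj v x) :
    Q ⊆ cliqueSpan G r v := by
  classical
  intro x hx
  have hclique := hQ.insert hv
  have hsub : ({v, x} : Finset V) ⊆ insert v Q := by
    intro y; simp only [mem_insert, mem_singleton]; grind
  obtain ⟨t, h1, h2, h3⟩ := exists_subsuperset_card_eq hsub (card_le_two.trans hr)
    (hrm.trans hclique.card_eq.ge)
  simp only [cliqueSpan, mem_filter, mem_univ, true_and]
  exact ⟨t, ⟨hclique.1.subset (by exact_mod_cast h2), h3⟩, h1 (by simp), h1 (by simp)⟩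

open Classical in
/-- In a graph whose non-neighbourhoods inside `W` are small, cliques extend greedily. -/
lemma exists_isNClique_of_card_nonneighbors_lt {G : SimpleGraph V} {r : ℕ} {W : Finset V}
    (hW : ∀ v ∈ W, r * (W.filter fun u => ¬ G.Adj v u).card < W.card)
    {T : Finset V} (hTW : T ⊆ W) (hT : G.IsClique T) (hTne : T.Nonempty) (hTr : T.card ≤ r) :
    ∃ t, T ⊆ t ∧ G.IsNClique r t := by
  induction h : r - T.card generalizing T with
  | zero => exact ⟨T, subset_rfl, hT, by omega⟩
  | succ k ih =>
    have hex : ∃ x ∈ W, ∀ y ∈ T, G.Adj x y := by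
      by_contra! hcon
      have hsub : W ⊆ T.biUnion fun v => W.filter fun u => ¬ G.Adj v u := by
        intro x hx
        obtain ⟨y, hy, hxy⟩ := hcon x hx
        simp only [mem_biUnion, mem_filter]
        exact ⟨y, hy, hx, fun h => hxy h.symm⟩
      have h1 := (card_le_card hsub).trans card_biUnion_le
      have h2 : ∑ v ∈ T, r * (W.filter fun u => ¬ G.Adj v u).card < ∑ _v ∈ T, W.card :=
        sum_lt_sum_of_nonempty hTne fun v hv => hW v (hTW hv)
      rw [← mul_sum, sum_const, smul_eq_mul] at h2
      have h3 := Nat.mul_le_mul_left r h1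
      have h4 := Nat.mul_le_mul_right W.card hTr
      omega
    obtain ⟨x, hx, hxT⟩ := hex
    have hxn : x ∉ T := fun h => G.irrefl (hxT x h)
    have hcard := card_insert_of_notMem hxn
    obtain ⟨t, ht, htc⟩ := ih (T := insert x T) (insert_subset hx hTW)
      (by
        rw [coe_insert]
        exact hT.insert fun y hy _ => hxT y hy)
      (insert_nonempty _ _) (by omega) (by omega)
    exact ⟨t, (subset_insert _ _).trans ht, htc⟩

open Classical in
lemma exists_many_nonneighbors [Fintype V] {G : SimpleGraph V} {r B : ℕ} (hr : 2 ≤ r)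
    {W : Finset V} (hlight : ∀ v ∈ W, (cliqueSpan G r v).card ≤ B) (hcard : 2 * B < W.card) :
    ∃ v ∈ W, W.card ≤ r * (W.filter fun u => ¬ G.Adj v u).card := by
  by_contra! hcon
  obtain ⟨v, hv⟩ : W.Nonempty := card_pos.1 (by omega)
  have hsub : (W.filter fun u => G.Adj v u) ⊆ cliqueSpan G r v := by
    intro x hx
    obtain ⟨hx, hvx⟩ := mem_filter.1 hx
    have hT : G.IsClique (({v, x} : Finset V) : Set V) := by
      rw [coe_pair]
      exact isClique_pair.2 fun _ => hvx
    obtain ⟨t, ht, htc⟩ := exists_isNClique_of_card_nonneighbors_lt hcon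
      (T := {v, x}) (by intro y; simp only [mem_insert, mem_singleton]; grind) hT
      (by simp) (card_le_two.trans hr)
    simp only [cliqueSpan, mem_filter, mem_univ, true_and]
    exact ⟨t, htc, ht (by simp), ht (by simp)⟩
  have h1 := card_le_card hsub
  have h2 := hlight v hv
  have h3 := card_filter_add_card_filter_not (s := W) (fun u => G.Adj v u)
  have h4 := hcon v hv
  have h5 := Nat.mul_le_mul_right (W.filter fun u => ¬ G.Adj v u).card hr
  omega

open Classical in
/-- A bounded set `C` covers all but a small proportion of the vertices which lie in few
copies of `K_r`. -/
lemma StronglyKSat.exists_core [Fintype V] {G : SimpleGraph V} {r s : ℕ} (hr : 2 ≤ r)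
    (hrs : r < s) (hG : StronglyKSat s G) (B k : ℕ) :
    ∃ C : Finset V, C.card ≤ k * B ∧
      ((univ.filter fun v => (cliqueSpan G r v).card ≤ B ∧
        ¬ CoveredBy G (s - 2) C v).card : ℝ) ≤
      (2 * B + r : ℕ) + (1 - 1 / (r : ℝ)) ^ k * Fintype.card V := by
  induction k with
  | zero =>
    refine ⟨∅, by simp, ?_⟩
    have : ((univ.filter fun v => (cliqueSpan G r v).card ≤ B ∧
        ¬ CoveredBy G (s - 2) ∅ v).card : ℝ) ≤ Fintype.card V := by
      exact_mod_cast card_le_univ _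
    have h0 : (0 : ℝ) ≤ (2 * B + r : ℕ) := Nat.cast_nonneg _
    simp only [pow_zero, one_mul]
    linarith
  | succ k ih =>
    obtain ⟨C, hC, hW⟩ := ih
    set W := univ.filter fun v => (cliqueSpan G r v).card ≤ B ∧ ¬ CoveredBy G (s - 2) C v
    have hr0 : (0 : ℝ) < r := by exact_mod_cast (by omega : 0 < r)
    have hq : (0 : ℝ) ≤ 1 - 1 / (r : ℝ) := by
      rw [sub_nonneg, div_le_one hr0]
      exact_mod_cast (by omega : 1 ≤ r)
    by_cases hsmall : W.card ≤ 2 * B + r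
    · refine ⟨C, hC.trans (Nat.mul_le_mul_right _ (Nat.le_succ k)), ?_⟩
      have h1 : (W.card : ℝ) ≤ (2 * B + r : ℕ) := by exact_mod_cast hsmall
      have h2 : 0 ≤ (1 - 1 / (r : ℝ)) ^ (k + 1) * Fintype.card V := by positivity
      linarith
    obtain ⟨v, hv, hvW⟩ := exists_many_nonneighbors (G := G) (r := r) (B := B) (W := W) hr
      (fun v hv => (mem_filter.1 hv).2.1) (by omega)
    set N := W.filter fun u => ¬ G.Adj v u
    have hcov : ∀ u, u ≠ v → ¬ G.Adj v u → CoveredBy G (s - 2) (C ∪ cliqueSpan G r v) u ∧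
        CoveredBy G (s - 2) (C ∪ cliqueSpan G r v) v := by
      intro u huv hadj
      obtain ⟨Q, hQ, hQadj⟩ := hG.exists_common_clique huv fun h => hadj h.symm
      have hsub : Q ⊆ C ∪ cliqueSpan G r v :=
        (subset_cliqueSpan_of_isNClique hr (by omega) hQ fun x hx => (hQadj x hx).2).trans
          subset_union_right
      exact ⟨⟨Q, hsub, hQ, fun x hx => (hQadj x hx).1⟩, Q, hsub, hQ, fun x hx => (hQadj x hx).2⟩
    have hNcard : 1 < N.card := by
      by_contra! hle
      have := Nat.mul_le_mul_left r hle
      omega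
    have hvcov : CoveredBy G (s - 2) (C ∪ cliqueSpan G r v) v := by
      obtain ⟨u, hu, huv⟩ := exists_mem_ne hNcard v
      exact (hcov u huv (mem_filter.1 hu).2).2
    refine ⟨C ∪ cliqueSpan G r v, ?_, ?_⟩
    · have h1 := card_union_le C (cliqueSpan G r v)
      have h2 := (mem_filter.1 hv).2.1
      rw [add_mul, one_mul]
      omega
    · have hsub : (univ.filter fun u => (cliqueSpan G r u).card ≤ B ∧
          ¬ CoveredBy G (s - 2) (C ∪ cliqueSpan G r v) u) ⊆ W.filter fun u => G.Adj v u := by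
        intro u hu
        obtain ⟨-, hu1, hu2⟩ := mem_filter.1 hu
        refine mem_filter.2 ⟨mem_filter.2 ⟨mem_univ _, hu1, fun h => hu2 (h.mono
          subset_union_left)⟩, ?_⟩
        by_contra hadj
        by_cases huv : u = v
        · exact hu2 (huv ▸ hvcov)
        · exact hu2 (hcov u huv hadj).1
      have h1 : ((univ.filter fun u => (cliqueSpan G r u).card ≤ B ∧
          ¬ CoveredBy G (s - 2) (C ∪ cliqueSpan G r v) u).card : ℝ) ≤
          (W.filter fun u => G.Adj v u).card := by exact_mod_cast card_le_card hsub
      have h2 : ((W.filter fun u => G.Adj v u).card : ℝ) + N.card = W.card := by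
        exact_mod_cast card_filter_add_card_filter_not (s := W) (fun u => G.Adj v u)
      have h3 : (W.card : ℝ) ≤ r * N.card := by exact_mod_cast hvW
      have h4 : (W.card : ℝ) / r ≤ N.card := by
        rw [div_le_iff₀ hr0]; linarith
      have h5 : ((W.filter fun u => G.Adj v u).card : ℝ) ≤ (1 - 1 / (r : ℝ)) * W.card := by
        have : (1 - 1 / (r : ℝ)) * W.card = W.card - W.card / r := by ring
        linarith
      have h6 := mul_le_mul_of_nonneg_left hW hq
      have h7 : (1 - 1 / (r : ℝ)) * (2 * B + r : ℕ) ≤ (2 * B + r : ℕ) := by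
        refine mul_le_of_le_one_left (Nat.cast_nonneg _) ?_
        have : 0 ≤ 1 / (r : ℝ) := by positivity
        linarith
      rw [pow_succ']
      linarith

lemma eq_and_eq_of_insert_eq_insert [DecidableEq V] {A B : Finset V} {u v : V} {C : Finset V}
    (hu : u ∉ C) (hv : v ∉ C) (hA : A ⊆ C) (hB : B ⊆ C) (h : insert u A = insert v B) :
    u = v ∧ A = B := by
  have huv : u = v := by
    have : u ∈ insert v B := h ▸ mem_insert_self u A
    rcases mem_insert.1 this with h | h
    · exact h
    · exact absurd (hB h) hu
  subst huv
  refine ⟨rfl, ?_⟩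
  rw [← erase_insert (fun h => hu (hA h)), h, erase_insert (fun h => hu (hB h))]

open Classical in
/-- Every covered vertex outside the core is the only vertex outside the core of
`m.choose k` copies of `K_{k+1}`. -/
lemma card_covered_mul_choose_le_cliqueCount [Fintype V] (G : SimpleGraph V) (m k : ℕ)
    (C : Finset V) :
    (univ.filter fun v => v ∉ C ∧ CoveredBy G m C v).card * m.choose k ≤
      cliqueCount G (k + 1) := by
  rw [cliqueCount_eq_card_filter]
  set S := univ.filter fun v => v ∉ C ∧ CoveredBy G m C v
  have hQ : ∀ v, ∃ Q : Finset V, v ∈ S → Q ⊆ C ∧ G.IsNClique m Q ∧ ∀ x ∈ Q, G.Adj v x := by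
    intro v
    by_cases hv : v ∈ S
    · obtain ⟨Q, hQ⟩ := (mem_filter.1 hv).2.2
      exact ⟨Q, fun _ => hQ⟩
    · exact ⟨∅, fun h => absurd h hv⟩
  choose Q hQ using hQ
  have hcard : (S.sigma fun v => powersetCard k (Q v)).card = S.card * m.choose k := by
    rw [card_sigma, sum_congr rfl (fun v hv => by
      rw [card_powersetCard, (hQ v hv).2.1.card_eq]), sum_const, smul_eq_mul]
  rw [← hcard]
  refine card_le_card_of_injOn (fun p => insert p.1 p.2) ?_ ?_
  · rintro ⟨v, t⟩ hp
    obtain ⟨hv, ht⟩ := mem_sigma.1 hp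
    obtain ⟨htQ, htk⟩ := mem_powersetCard.1 ht
    obtain ⟨-, hQc, hQv⟩ := hQ v hv
    refine mem_coe.2 (mem_filter.2 ⟨mem_univ _, ?_⟩)
    have htc : G.IsNClique k t := ⟨hQc.1.subset (by exact_mod_cast htQ), htk⟩
    exact htc.insert fun x hx => hQv x (htQ hx)
  · rintro ⟨u, t⟩ hp ⟨v, t'⟩ hp' heq
    obtain ⟨hu, ht⟩ := mem_sigma.1 hp
    obtain ⟨hv, ht'⟩ := mem_sigma.1 hp'
    obtain ⟨rfl, rfl⟩ := eq_and_eq_of_insert_eq_insert (mem_filter.1 hu).2.1 (mem_filter.1 hv).2.1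
      ((mem_powersetCard.1 ht).1.trans (hQ u hu).1)
      ((mem_powersetCard.1 ht').1.trans (hQ v hv).1) heq
    rfl

/-- Up to parameters, the lower bound on the number of copies of `K_r`. -/
lemma StronglyKSat.le_cliqueCount_add [Fintype V] {G : SimpleGraph V} {r s : ℕ} (hr : 2 ≤ r)
    (hrs : r < s) (hG : StronglyKSat s G) (B k : ℕ) (hB : 0 < B) :
    ((s - 2).choose (r - 1) : ℝ) * (Fintype.card V - r ^ 2 * cliqueCount G r / B - k * B -
      ((2 * B + r : ℕ) + (1 - 1 / (r : ℝ)) ^ k * Fintype.card V)) ≤ cliqueCount G r := by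
  classical
  obtain ⟨C, hC, hW⟩ := hG.exists_core hr hrs B k
  set W := univ.filter fun v => (cliqueSpan G r v).card ≤ B ∧ ¬ CoveredBy G (s - 2) C v
  set S := univ.filter fun v => v ∉ C ∧ CoveredBy G (s - 2) C v
  set H := univ.filter fun v => ¬ (cliqueSpan G r v).card ≤ B
  have hcover : (univ : Finset V) ⊆ S ∪ (H ∪ (C ∪ W)) := by
    intro v _
    simp only [S, H, W, mem_union, mem_filter, mem_univ, true_and]
    tauto
  have h1 : Fintype.card V ≤ S.card + (H.card + (C.card + W.card)) := by
    rw [← card_univ]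
    refine (card_le_card hcover).trans ((card_union_le _ _).trans ?_)
    gcongr
    refine (card_union_le _ _).trans ?_
    gcongr
    exact card_union_le _ _
  have h2 : H.card * B ≤ r ^ 2 * cliqueCount G r := by
    refine le_trans ?_ (sum_card_cliqueSpan_le G r)
    rw [← smul_eq_mul]
    refine (card_nsmul_le_sum H _ B fun v hv => ?_).trans
      (sum_le_sum_of_subset (subset_univ H))
    exact (not_le.1 (mem_filter.1 hv).2).le
  have h3 := card_covered_mul_choose_le_cliqueCount G (s - 2) (r - 1) C
  rw [Nat.sub_add_cancel (by omega : 1 ≤ r)] at h3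
  have hB' : (0 : ℝ) < B := by exact_mod_cast hB
  have h2' : (H.card : ℝ) ≤ r ^ 2 * cliqueCount G r / B := by
    rw [le_div_iff₀ hB']
    exact_mod_cast h2
  have h1' : (Fintype.card V : ℝ) ≤ S.card + (H.card + (C.card + W.card)) := by
    exact_mod_cast h1
  have hC' : (C.card : ℝ) ≤ k * B := by exact_mod_cast hC
  have h3' : (S.card : ℝ) * (s - 2).choose (r - 1) ≤ cliqueCount G r := by exact_mod_cast h3
  refine le_trans ?_ h3'
  rw [mul_comm]
  refine mul_le_mul_of_nonneg_right ?_ (Nat.cast_nonneg _)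
  linarith

lemma StronglyKSat.asymptotic_le_cliqueCount {r s : ℕ} (hr : 2 ≤ r) (hrs : r < s) {ε : ℝ}
    (hε : 0 < ε) :
    ∃ n₀ : ℕ, ∀ n ≥ n₀, ∀ G : SimpleGraph (Fin n), StronglyKSat s G →
      (((s - 2).choose (r - 1) : ℝ) - ε) * n ≤ (cliqueCount G r : ℝ) := by
  set c : ℝ := (((s - 2).choose (r - 1) : ℕ) : ℝ) with hc
  have hc0 : 0 < c := by
    rw [hc]
    exact_mod_cast Nat.choose_pos (by omega : r - 1 ≤ s - 2)
  have hr0 : (0 : ℝ) < r := by exact_mod_cast (by omega : 0 < r)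
  set δ : ℝ := ε / c / 3 with hδ
  have hδ0 : 0 < δ := by positivity
  obtain ⟨B, hB⟩ := exists_nat_gt (r ^ 2 * c / δ)
  have hB0 : (0 : ℝ) < B := lt_of_le_of_lt (by positivity) hB
  obtain ⟨k, hk⟩ := exists_pow_lt_of_lt_one hδ0 (y := 1 - 1 / (r : ℝ))
    (by have : 0 < 1 / (r : ℝ) := by positivity
        linarith)
  obtain ⟨n₀, hn₀⟩ := exists_nat_gt ((k * B + (2 * B + r : ℕ) : ℝ) / δ)
  refine ⟨n₀, fun n hn G hG => ?_⟩
  by_cases hlarge : c * n ≤ cliqueCount G r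
  · refine le_trans ?_ hlarge
    have : 0 ≤ ε * n := by positivity
    linarith
  push Not at hlarge
  have hmain := hG.le_cliqueCount_add hr hrs B k (by exact_mod_cast hB0)
  rw [Fintype.card_fin, ← hc] at hmain
  refine le_trans ?_ hmain
  have hn' : (n₀ : ℝ) ≤ n := by exact_mod_cast hn
  have h1 : (k * B + (2 * B + r : ℕ) : ℝ) ≤ δ * n := by
    rw [div_lt_iff₀ hδ0] at hn₀
    nlinarith
  have h2 : (1 - 1 / (r : ℝ)) ^ k * n ≤ δ * n := by gcongr
  have h3 : (r : ℝ) ^ 2 * cliqueCount G r / B ≤ δ * n := by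
    rw [div_lt_iff₀ hδ0] at hB
    rw [div_le_iff₀ hB0]
    calc (r : ℝ) ^ 2 * cliqueCount G r ≤ r ^ 2 * (c * n) := by gcongr
      _ = r ^ 2 * c * n := by ring
      _ ≤ B * δ * n := by gcongr
      _ = δ * n * B := by ring
  have h4 : (c - ε) * n = c * (n - 3 * (δ * n)) := by
    rw [hδ]; field_simp
  rw [h4]
  refine mul_le_mul_of_nonneg_left ?_ hc0.le
  linarith

lemma joinGraph_adj {n s : ℕ} {i j : Fin n} :
    (joinGraph n s).Adj i j ↔ i ≠ j ∧ ((i : ℕ) < s - 2 ∨ (j : ℕ) < s - 2) := by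
  simp [joinGraph]

lemma card_filter_val_lt_sub_two {n s : ℕ} (h : s ≤ n) :
    (univ.filter fun i : Fin n => (i : ℕ) < s - 2).card = s - 2 := by
  rw [Fin.card_filter_val_lt]
  omega

lemma stronglyKSat_joinGraph {n s : ℕ} (hs : 2 ≤ s) (hsn : s ≤ n) :
    StronglyKSat s (joinGraph n s) := by
  intro u v huv hadj
  rw [joinGraph_adj] at hadj
  have hu : ¬ (u : ℕ) < s - 2 := fun h => hadj ⟨huv, Or.inl h⟩
  have hv : ¬ (v : ℕ) < s - 2 := fun h => hadj ⟨huv, Or.inr h⟩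
  refine ⟨insert u (insert v (univ.filter fun i : Fin n => (i : ℕ) < s - 2)), ⟨?_, ?_⟩,
    by simp, by simp⟩
  · intro a ha b hb hab
    simp only [coe_insert, coe_filter, mem_univ, true_and, Set.mem_insert_iff,
      Set.mem_ofPred_eq] at ha hb
    simp only [addEdge, sup_adj, fromEdgeSet_adj, Set.mem_singleton_iff, Sym2.eq_iff,
      joinGraph_adj]
    grind
  · rw [card_insert_of_notMem (by simp [huv, hu]), card_insert_of_notMem (by simpa using hv),
      card_filter_val_lt_sub_two hsn]
    omega

lemma cliqueCount_joinGraph {n r s : ℕ} (hr : 1 ≤ r) (hs : 2 ≤ s) (hsn : s ≤ n) :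
    cliqueCount (joinGraph n s) r =
      (n - s + 2) * (s - 2).choose (r - 1) + (s - 2).choose r := by
  classical
  set A := univ.filter fun i : Fin n => (i : ℕ) < s - 2 with hA
  have hAc : A.card = s - 2 := card_filter_val_lt_sub_two hsn
  have hmemA : ∀ i, i ∈ A ↔ (i : ℕ) < s - 2 := by simp [hA]
  have hcliqueA : (joinGraph n s).IsClique (A : Set (Fin n)) := by
    intro a ha b _ hab
    exact joinGraph_adj.2 ⟨hab, Or.inl ((hmemA a).1 ha)⟩
  have heq : {t : Finset (Fin n) | (joinGraph n s).IsNClique r t} =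
      (((Aᶜ ×ˢ powersetCard (r - 1) A).image fun p => insert p.1 p.2) ∪ powersetCard r A :
        Finset (Finset (Fin n))) := by
    ext t
    simp only [Set.mem_ofPred_eq, mem_coe, mem_union, mem_image, mem_product, mem_compl,
      mem_powersetCard, Prod.exists]
    constructor
    · intro ht
      by_cases htA : t ⊆ A
      · exact Or.inr ⟨htA, ht.card_eq⟩
      obtain ⟨v, hv, hvA⟩ := not_subset.1 htA
      refine Or.inl ⟨v, t.erase v, ⟨hvA, ?_, ?_⟩, insert_erase hv⟩
      · intro x hx
        obtain ⟨hxv, hx⟩ := mem_erase.1 hx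
        have := joinGraph_adj.1 (ht.1 hx hv hxv)
        rw [hmemA] at hvA ⊢
        exact this.2.resolve_right hvA
      · rw [card_erase_of_mem hv, ht.card_eq]
    · rintro (⟨v, t', ⟨hv, ht', hcard⟩, rfl⟩ | ⟨htA, hcard⟩)
      · have h1 : (joinGraph n s).IsNClique (r - 1) t' :=
          ⟨hcliqueA.subset (by exact_mod_cast ht'), hcard⟩
        have h2 := h1.insert (a := v) fun x hx =>
          joinGraph_adj.2 ⟨fun h => hv (h ▸ ht' hx), Or.inr ((hmemA x).1 (ht' hx))⟩
        rwa [Nat.sub_add_cancel hr] at h2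
      · exact ⟨hcliqueA.subset (by exact_mod_cast htA), hcard⟩
  rw [cliqueCount, heq, Set.ncard_coe_finset, card_union_of_disjoint, card_image_of_injOn,
    card_product, card_powersetCard, card_powersetCard, card_compl, hAc, Fintype.card_fin]
  · congr 2
    omega
  · rintro ⟨u, t⟩ hp ⟨v, t'⟩ hp' h
    simp only [coe_product, Set.mem_prod, mem_coe, mem_compl, mem_powersetCard] at hp hp'
    obtain ⟨rfl, rfl⟩ := eq_and_eq_of_insert_eq_insert hp.1 hp'.1 hp.2.1 hp'.2.1 h
    rfl
  · rw [Finset.disjoint_left]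
    intro t ht ht'
    obtain ⟨⟨v, t'⟩, hp, rfl⟩ := mem_image.1 ht
    exact mem_compl.1 (mem_product.1 hp).1 ((mem_powersetCard.1 ht').1 (mem_insert_self _ _))

/-- For all integers `s > r ≥ 2`: (i) for every `ε > 0` there is `n₀` such that
every strongly `K_s`-saturated graph on `n ≥ n₀` vertices has at least `(C(s-2,r-1) - ε)·n`
copies of `K_r`; (ii) for every `n ≥ s` there is a strongly `K_s`-saturated graph on `n`
vertices with exactly `(n-s+2)·C(s-2,r-1) + C(s-2,r)` copies of `K_r`. Consequently
`ssat(n, K_r, K_s) = n·C(s-2,r-1) - o(n)`. -/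
theorem ssat_cliques (r s : ℕ) (hr : 2 ≤ r) (hrs : r < s) :
    (∀ ε : ℝ, 0 < ε → ∃ n₀ : ℕ, ∀ n ≥ n₀, ∀ G : SimpleGraph (Fin n),
        StronglyKSat s G → (((s - 2).choose (r - 1) : ℝ) - ε) * n ≤ (cliqueCount G r : ℝ)) ∧
    (∀ n : ℕ, s ≤ n → ∃ G : SimpleGraph (Fin n), StronglyKSat s G ∧
        cliqueCount G r = (n - s + 2) * (s - 2).choose (r - 1) + (s - 2).choose r) ∧
    ((fun n : ℕ => ((n : ℝ) * (s - 2).choose (r - 1)) - (ssatCliques n r s : ℝ))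
      =o[Filter.atTop] fun n : ℕ => (n : ℝ)) := by
  refine ⟨fun ε hε => StronglyKSat.asymptotic_le_cliqueCount hr hrs hε, fun n hn =>
    ⟨joinGraph n s, stronglyKSat_joinGraph (by omega) hn,
      cliqueCount_joinGraph (by omega) (by omega) hn⟩, ?_⟩
  rw [Asymptotics.isLittleO_iff]
  intro ε hε
  obtain ⟨n₀, hn₀⟩ := StronglyKSat.asymptotic_le_cliqueCount hr hrs hε
  obtain ⟨n₁, hn₁⟩ := exists_nat_gt (((s - 2).choose r : ℝ) / ε)
  filter_upwards [Filter.eventually_ge_atTop n₀, Filter.eventually_ge_atTop n₁,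
    Filter.eventually_ge_atTop s] with n h0 h1 hs
  have hmem : (n - s + 2) * (s - 2).choose (r - 1) + (s - 2).choose r ∈
      {m | ∃ G : SimpleGraph (Fin n), StronglyKSat s G ∧ cliqueCount G r = m} :=
    ⟨joinGraph n s, stronglyKSat_joinGraph (by omega) hs,
      cliqueCount_joinGraph (by omega) (by omega) hs⟩
  obtain ⟨G, hG, hGc⟩ := Nat.sInf_mem ⟨_, hmem⟩
  have hlow := hn₀ n h0 G hG
  rw [hGc] at hlow
  change _ ≤ (ssatCliques n r s : ℝ) at hlow
  have hup : ssatCliques n r s ≤ n * (s - 2).choose (r - 1) + (s - 2).choose r := by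
    refine (Nat.sInf_le hmem).trans ?_
    gcongr
    omega
  have hup' : (ssatCliques n r s : ℝ) ≤ n * (s - 2).choose (r - 1) + (s - 2).choose r := by
    exact_mod_cast hup
  have hconst : ((s - 2).choose r : ℝ) ≤ ε * n := by
    rw [div_lt_iff₀ hε] at hn₁
    have : (n₁ : ℝ) ≤ n := by exact_mod_cast h1
    nlinarith
  rw [Real.norm_eq_abs, Real.norm_eq_abs, Nat.abs_cast, abs_le]
  constructor <;> linarith
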